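/- arXiv:2009.02497 — 4 statements merged into one kernel-verified Lean document; each statement's English description precedes it below -/
import Mathlib

section
/- Let R be a (not necessarily commutative) ring and S a left denominator set in R. Let ρ : R → S⁻¹R denote the structural homomorphism into the left Ore localization of R at S. Then for every left ideal I of R, the preimage under ρ of the left ideal of S⁻¹R generated by ρ(I) equals the left saturation closure {r ∈ R | ∃ s ∈ S, s·r ∈ I}. (In the paper's notation: I^S = LSat_S(I).) -/
/-- Let `R` be a ring and `S` a left denominator set in `R`.
Let `ρ : R → T` be the structural homomorphism into the left Ore localization
`T = S⁻¹R` of `R` at `S` (characterized axiomatically). Then for every left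
ideal `I` of `R`, the preimage under `ρ` of the left ideal of `T` generated by
`ρ(I)` equals the left saturation closure `{r ∈ R | ∃ s ∈ S, s·r ∈ I}`. -/
theorem stmt0 {R T : Type*} [Ring R] [Ring T] (S : Set R)
    -- `S` is a multiplicative set:
    (hS1 : (1 : R) ∈ S) (hS0 : (0 : R) ∉ S)
    (hSmul : ∀ s ∈ S, ∀ t ∈ S, s * t ∈ S)
    -- left Ore condition:
    (hOre : ∀ s ∈ S, ∀ r : R, ∃ s' ∈ S, ∃ r' : R, s' * r = r' * s)
    -- left reversibility:
    (hRev : ∀ s ∈ S, ∀ r : R, r * s = 0 → ∃ s' ∈ S, s' * r = 0)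
    -- `ρ : R → T` is a left Ore localization of `R` at `S`:
    (ρ : R →+* T)
    (hUnit : ∀ s ∈ S, IsUnit (ρ s))
    (hFrac : ∀ x : T, ∃ s ∈ S, ∃ r : R, ρ s * x = ρ r)
    (hKer : ∀ r : R, ρ r = 0 ↔ ∃ s ∈ S, s * r = 0)
    (I : Ideal R) :
    ((Ideal.span (ρ '' (I : Set R))).comap ρ : Set R)
      = {r : R | ∃ s ∈ S, s * r ∈ I} := by
  have key : ∀ x ∈ Ideal.span (ρ '' (I : Set R)), ∃ s ∈ S, ∃ a ∈ I, ρ s * x = ρ a := by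
    intro x hx
    induction hx using Submodule.span_induction with
    | mem x h =>
      obtain ⟨a, ha, rfl⟩ := h
      exact ⟨1, hS1, a, ha, by simp⟩
    | zero => exact ⟨1, hS1, 0, I.zero_mem, by simp⟩
    | add x y _ _ hx hy =>
      obtain ⟨s, hs, a, ha, hxa⟩ := hx
      obtain ⟨t, ht, b, hb, hyb⟩ := hy
      obtain ⟨s', hs', r', h⟩ := hOre t ht s
      refine ⟨s' * s, hSmul _ hs' _ hs, s' * a + r' * b,
        I.add_mem (I.mul_mem_left _ ha) (I.mul_mem_left _ hb), ?_⟩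
      rw [mul_add]
      nth_rewrite 2 [h]
      simp only [map_mul, map_add, mul_assoc, hxa, hyb]
    | smul c x _ hx =>
      obtain ⟨s, hs, a, ha, hxa⟩ := hx
      obtain ⟨t, ht, r, hc⟩ := hFrac c
      obtain ⟨s', hs', r', h⟩ := hOre s hs r
      refine ⟨s' * t, hSmul _ hs' _ ht, r' * a, I.mul_mem_left _ ha, ?_⟩
      calc ρ (s' * t) * (c • x) = ρ s' * (ρ t * c) * x := by
            simp only [map_mul, smul_eq_mul, mul_assoc]
        _ = ρ (s' * r) * x := by rw [hc, map_mul]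
        _ = ρ (r' * a) := by rw [h, map_mul, mul_assoc, hxa, map_mul]
  ext r
  simp only [SetLike.mem_coe, Ideal.mem_comap, Set.mem_setOf_eq]
  constructor
  · intro hr
    obtain ⟨s, hs, a, ha, h⟩ := key _ hr
    obtain ⟨u, hu, h0⟩ := (hKer (s * r - a)).1 (by rw [map_sub, map_mul, h, sub_self])
    refine ⟨u * s, hSmul _ hu _ hs, ?_⟩
    rw [mul_sub, sub_eq_zero] at h0
    rw [mul_assoc, h0]
    exact I.mul_mem_left _ ha
  · rintro ⟨s, hs, h⟩
    obtain ⟨v, hv⟩ := hUnit s hs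
    have h1 : ρ (s * r) ∈ Ideal.span (ρ '' (I : Set R)) :=
      Ideal.subset_span ⟨_, h, rfl⟩
    have h2 := Ideal.mul_mem_left _ (↑v⁻¹ : T) h1
    rwa [map_mul, ← hv, Units.inv_mul_cancel_left] at h2
end

section
/- Let S be a multiplicative submonoid of a commutative ring R and let I be a decomposable ideal, i.e. I = Q₁ ∩ … ∩ Qₙ with each Qᵢ a primary ideal of R. Then the S-saturation I^S := {r ∈ R | ∃ s ∈ S, s·r ∈ I} equals the intersection of those Qᵢ with Qᵢ ∩ S = ∅ (where the empty intersection is taken to be R). -/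
/-- Let `S` be a multiplicative submonoid of a commutative ring `R`
and `I = Q₁ ∩ … ∩ Qₙ` a decomposable ideal with each `Qᵢ` primary. Then the
`S`-saturation `I^S = {r ∈ R | ∃ s ∈ S, s·r ∈ I}` equals the intersection of
those `Qᵢ` with `Qᵢ ∩ S = ∅` (the empty intersection being all of `R`). -/
theorem stmt8 {R : Type*} [CommRing R] (S : Submonoid R) {n : ℕ}
    (Q : Fin n → Ideal R) (hQ : ∀ i, (Q i).IsPrimary)
    (I : Ideal R) (hI : I = ⨅ i, Q i) :
    {r : R | ∃ s ∈ S, s * r ∈ I}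
      = ⋂ i ∈ {i : Fin n | (Q i : Set R) ∩ (S : Set R) = ∅}, (Q i : Set R) := by
  subst hI
  ext r
  simp only [Set.mem_setOf_eq, Set.mem_iInter, SetLike.mem_coe, Ideal.mem_iInf]
  constructor
  · rintro ⟨s, hs, h⟩ i hi
    have h1 : r * s ∈ Q i := by
      rw [mul_comm]
      exact h i
    rcases (Ideal.isPrimary_iff.mp (hQ i)).2 h1 with h2 | h2
    · exact h2
    · obtain ⟨k, hk⟩ := Ideal.mem_radical_iff.mp h2
      have h3 : s ^ k ∈ (Q i : Set R) ∩ (S : Set R) := ⟨hk, pow_mem hs k⟩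
      rw [hi] at h3
      exact h3.elim
  · intro h
    have key : ∀ i, ∃ s ∈ S, s * r ∈ Q i := by
      intro i
      by_cases hi : (Q i : Set R) ∩ (S : Set R) = ∅
      · exact ⟨1, S.one_mem, by simpa using h i hi⟩
      · obtain ⟨s, hs, hs2⟩ := Set.nonempty_iff_ne_empty.mpr hi
        exact ⟨s, hs2, (Q i).mul_mem_right r hs⟩
    choose s hs hsr using key
    refine ⟨∏ i, s i, S.prod_mem fun i _ => hs i, fun i => ?_⟩
    obtain ⟨c, hc⟩ := Finset.dvd_prod_of_mem s (Finset.mem_univ i)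
    rw [hc, mul_comm (s i) c, mul_assoc]
    exact (Q i).mul_mem_left c (hsr i)
end

section
/- Let S be a multiplicative submonoid of a commutative ring R and I a decomposable ideal of R, i.e. I = Q₁ ∩ … ∩ Qₙ with each Qᵢ primary. Then there exists an ideal J of R such that I = I^S ∩ J and the extension of J to the localization S⁻¹R is the whole ring S⁻¹R, where I^S := {r ∈ R | ∃ s ∈ S, s·r ∈ I} is the S-saturation of I. -/
/-- Let `S` be a multiplicative submonoid of a commutative ring `R`
and `I = Q₁ ∩ … ∩ Qₙ` a decomposable ideal with each `Qᵢ` primary. Then there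
exists an ideal `J` of `R` such that `I = I^S ∩ J` and the extension of `J` to
the localization `S⁻¹R` is all of `S⁻¹R`, where
`I^S = {r ∈ R | ∃ s ∈ S, s·r ∈ I}`. -/
theorem stmt9 {R : Type*} [CommRing R] (S : Submonoid R) {n : ℕ}
    (Q : Fin n → Ideal R) (hQ : ∀ i, (Q i).IsPrimary)
    (I : Ideal R) (hI : I = ⨅ i, Q i) :
    ∃ J : Ideal R,
      (I : Set R) = {r : R | ∃ s ∈ S, s * r ∈ I} ∩ (J : Set R) ∧
      Ideal.map (algebraMap R (Localization S)) J = ⊤ := by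
  classical
  subst hI
  refine ⟨⨅ i, ⨅ _ : ∃ s ∈ S, s ∈ Q i, Q i, ?_, ?_⟩
  · ext r
    simp only [SetLike.mem_coe, Set.mem_inter_iff, Set.mem_setOf_eq, Ideal.mem_iInf]
    constructor
    · intro h
      exact ⟨⟨1, S.one_mem, fun i => by simpa using h i⟩, fun i _ => h i⟩
    · rintro ⟨⟨s, hs, hsr⟩, hJ⟩ i
      by_cases hi : ∃ s ∈ S, s ∈ Q i
      · exact hJ i hi
      · have h := hsr i
        rw [mul_comm] at h
        rcases (Ideal.isPrimary_iff.mp (hQ i)).2 h with h | ⟨k, hk⟩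
        · exact h
        · exact absurd ⟨s ^ k, S.pow_mem hs k, hk⟩ hi
  · have key : ∀ i, ∃ s ∈ S, (∃ t ∈ S, t ∈ Q i) → s ∈ Q i := by
      intro i
      by_cases hi : ∃ t ∈ S, t ∈ Q i
      · obtain ⟨t, ht, h⟩ := hi
        exact ⟨t, ht, fun _ => h⟩
      · exact ⟨1, S.one_mem, fun h => absurd h hi⟩
    choose f hf hfQ using key
    apply IsLocalization.map_eq_top_of_not_subset S
    intro hsub
    refine hsub (a := ∏ i, f i) ?_ (S.prod_mem fun i _ => hf i)
    simp only [SetLike.mem_coe, Ideal.mem_iInf]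
    intro i hi
    exact Ideal.mem_of_dvd _ (Finset.dvd_prod_of_mem f (Finset.mem_univ i)) (hfQ i hi)
end

section
/- Let R be a (not necessarily commutative) ring, I a left ideal of R, q an element of the center of R, and n ∈ ℕ₀ such that (I : q^{2n}) = (I : q^n), where for k ∈ ℕ₀ the central quotient is (I : q^k) := {f ∈ R | q^k·f ∈ I} (this hypothesis holds when n is the central saturation index of I by q). Then I = ⟨I, q^n⟩ ∩ (I : q^n), where ⟨I, q^n⟩ denotes the left ideal generated by I together with q^n. -/
/-- Let `R` be a ring, `I` a left ideal of `R`, `q` a central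
element of `R` and `n ∈ ℕ₀` such that `(I : q^{2n}) = (I : q^n)` (which holds
when `n` is the central saturation index of `I` by `q`). Then
`I = ⟨I, q^n⟩ ∩ (I : q^n)`, where `⟨I, q^n⟩` is the left ideal generated by `I`
together with `q^n` and `(I : q^k) = {f ∈ R | q^k·f ∈ I}`. -/
theorem stmt12 {R : Type*} [Ring R] (I : Ideal R) (q : R)
    (hq : q ∈ Set.center R) (n : ℕ)
    (hsat : {f : R | q ^ (2 * n) * f ∈ I} = {f : R | q ^ n * f ∈ I}) :
    (I : Set R) = ((I ⊔ Ideal.span {q ^ n} : Ideal R) : Set R)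
      ∩ {f : R | q ^ n * f ∈ I} := by
  have hc : ∀ r : R, r * q ^ n = q ^ n * r := fun r =>
    (Commute.pow_right (Semigroup.mem_center_iff.mp hq r) n).eq
  ext f
  constructor
  · intro hf
    exact ⟨Ideal.mem_sup_left hf, I.mul_mem_left _ hf⟩
  · rintro ⟨hf, hqf⟩
    obtain ⟨a, ha, b, hb, rfl⟩ := Submodule.mem_sup.mp hf
    obtain ⟨r, rfl⟩ := Ideal.mem_span_singleton'.mp hb
    have hqf' : q ^ n * (a + r * q ^ n) ∈ I := hqf
    rw [mul_add] at hqf'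
    have h1 : q ^ n * (r * q ^ n) ∈ I :=
      (I.add_mem_iff_right (I.mul_mem_left _ ha)).mp hqf'
    have h2 : r ∈ {f : R | q ^ (2 * n) * f ∈ I} := by
      show q ^ (2 * n) * r ∈ I
      rw [two_mul, pow_add, mul_assoc, ← hc r]
      exact h1
    rw [hsat] at h2
    have h3 : q ^ n * r ∈ I := h2
    rw [← hc r] at h3
    exact I.add_mem ha h3
end
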